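/- For every n ≥ 1 and every d with 1 ≤ d ≤ n, there exists an (n+1) × (n+1) real matrix M, with rows and columns indexed by {0,1,...,n}, such that γ₂(M) ≤ d and M_{st} = s − t for all s, t ∈ {0,1,...,n} with |s − t| ≤ d. -/

import Mathlib

/-- Maximum ℓ2 norm of a column of `X`. -/
noncomputable def colNorm {k m : Type*} [Fintype k] [Fintype m] (X : Matrix k m ℝ) : ℝ :=
  ⨆ j : m, Real.sqrt (∑ i, X i j ^ 2)

/-- The `γ₂` (factorization) norm of a real matrix `A`:
`γ₂(A) = min { c(X)·c(Y) : XᵀY = A }` where `c(·)` is the maximum column ℓ2 norm. -/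
noncomputable def gamma2 {m l : Type*} [Fintype m] [Fintype l] (A : Matrix m l ℝ) : ℝ :=
  sInf {c : ℝ | ∃ (k : ℕ) (X : Matrix (Fin k) m ℝ) (Y : Matrix (Fin k) l ℝ),
    X.transpose * Y = A ∧ c = colNorm X * colNorm Y}

/-- The `±1`-valued square wave on `ℕ` that changes sign after every `m` steps. -/
noncomputable def squareWave (m x : ℕ) : ℝ := (-1) ^ (x / m)

lemma squareWave_sq (m x : ℕ) : squareWave m x ^ 2 = 1 := by
  rw [squareWave, ← pow_mul, mul_comm, pow_mul]
  norm_num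

lemma squareWave_add {m : ℕ} (hm : 0 < m) (x : ℕ) :
    squareWave m (x + m) = -squareWave m x := by
  rw [squareWave, Nat.add_div_right _ hm, pow_succ, squareWave]
  ring

lemma squareWave_of_lt {m x : ℕ} (hx : x < m) : squareWave m x = 1 := by
  simp [squareWave, Nat.div_eq_of_lt hx]

/-- The sum of an `m`-periodic function over `m` consecutive points does not depend on the
starting point. -/
lemma sum_range_add_of_periodic {f : ℕ → ℝ} {m : ℕ} (hf : Function.Periodic f m) (a : ℕ) :
    ∑ i ∈ Finset.range m, f (a + i) = ∑ i ∈ Finset.range m, f i := by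
  induction a with
  | zero => simp
  | succ a ih =>
    rw [← ih]
    have h := Finset.sum_range_succ (fun i => f (a + i)) m
    rw [Finset.sum_range_succ', hf a, add_zero] at h
    simpa only [add_right_comm a 1, ← add_assoc] using add_right_cancel h

/-- The autocorrelation of the square wave is a triangle wave. -/
lemma sum_squareWave_mul {m h : ℕ} (hm : 0 < m) (hh : h ≤ m) (a : ℕ) :
    ∑ i ∈ Finset.range m, squareWave m (a + i) * squareWave m (a + i + h) =
      (m : ℝ) - 2 * h := by
  have hper : Function.Periodic (fun x => squareWave m x * squareWave m (x + h)) m := by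
    intro x
    simp only [add_right_comm x m h, squareWave_add hm, neg_mul_neg]
  rw [sum_range_add_of_periodic hper a]
  obtain ⟨k, rfl⟩ := Nat.exists_eq_add_of_le' hh
  rw [Finset.sum_range_add]
  have h₁ : ∀ i ∈ Finset.range k,
      squareWave (k + h) i * squareWave (k + h) (i + h) = 1 := by
    intro i hi
    rw [Finset.mem_range] at hi
    rw [squareWave_of_lt (by omega), squareWave_of_lt (by omega), one_mul]
  have h₂ : ∀ i ∈ Finset.range h,
      squareWave (k + h) (k + i) * squareWave (k + h) (k + i + h) = -1 := by
    intro i hi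
    rw [Finset.mem_range] at hi
    rw [show k + i + h = i + (k + h) by omega, squareWave_add hm,
      squareWave_of_lt (by omega), squareWave_of_lt (by omega), one_mul]
  rw [Finset.sum_congr rfl h₁, Finset.sum_congr rfl h₂]
  simp only [Finset.sum_const, Finset.card_range, nsmul_eq_mul]
  push_cast
  ring

lemma colNorm_nonneg {k m : Type*} [Fintype k] [Fintype m] (X : Matrix k m ℝ) :
    0 ≤ colNorm X :=
  Real.iSup_nonneg fun _ => Real.sqrt_nonneg _

lemma gamma2_transpose_mul_le {m l : Type*} [Fintype m] [Fintype l] {k : ℕ}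
    (X : Matrix (Fin k) m ℝ) (Y : Matrix (Fin k) l ℝ) :
    gamma2 (X.transpose * Y) ≤ colNorm X * colNorm Y := by
  refine csInf_le ⟨0, ?_⟩ ⟨k, X, Y, rfl, rfl⟩
  rintro _ ⟨_, X', Y', _, rfl⟩
  exact mul_nonneg (colNorm_nonneg X') (colNorm_nonneg Y')

/-- The matrix whose columns are the shifts by `c`, `c + 1`, … of the square wave of half-period
`2 * d`, scaled to have norm `√d`. -/
noncomputable def waveMatrix (n d c : ℕ) : Matrix (Fin (2 * d)) (Fin (n + 1)) ℝ :=
  fun i s => squareWave (2 * d) (s + c + i) / √2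

lemma colNorm_waveMatrix (n d c : ℕ) : colNorm (waveMatrix n d c) = √d := by
  simp [colNorm, waveMatrix, div_pow, squareWave_sq]
  field_simp

lemma waveMatrix_transpose_mul_apply {n d : ℕ} (hd : 0 < d) (s t : Fin (n + 1))
    (hst : |(s : ℝ) - (t : ℝ)| ≤ (d : ℝ)) :
    ((waveMatrix n d 0).transpose * waveMatrix n d d) s t = (s : ℝ) - (t : ℝ) := by
  obtain ⟨h₁, h₂⟩ := abs_le.mp hst
  have hs : (s : ℕ) ≤ t + d := by
    have : (s : ℝ) ≤ t + d := by linarith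
    exact_mod_cast this
  have ht : (t : ℕ) ≤ s + d := by
    have : (t : ℝ) ≤ s + d := by linarith
    exact_mod_cast this
  obtain ⟨h, hh⟩ := Nat.exists_eq_add_of_le hs
  have hsum := sum_squareWave_mul (m := 2 * d) (h := h) (by omega) (by omega) s
  have hcast : (t : ℝ) + d = s + h := by exact_mod_cast hh
  simp only [Matrix.mul_apply, Matrix.transpose_apply, waveMatrix, add_zero, hh,
    div_mul_div_comm, Real.mul_self_sqrt zero_le_two, ← Finset.sum_div, add_right_comm _ h]
  rw [Fin.sum_univ_eq_sum_range
    (fun i => squareWave (2 * d) (s + i) * squareWave (2 * d) (s + i + h)), hsum]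
  push_cast
  linarith

/-- For every `n ≥ 1` and `1 ≤ d ≤ n` there is an `(n+1) × (n+1)` real
matrix `M` with `γ₂(M) ≤ d` and `M s t = s - t` whenever `|s - t| ≤ d`. -/
theorem exists_gamma2_matrix (n d : ℕ) (hn : 1 ≤ n) (hd1 : 1 ≤ d) (hdn : d ≤ n) :
    ∃ M : Matrix (Fin (n + 1)) (Fin (n + 1)) ℝ,
      gamma2 M ≤ (d : ℝ) ∧
      ∀ s t : Fin (n + 1), |(s : ℝ) - (t : ℝ)| ≤ (d : ℝ) → M s t = (s : ℝ) - (t : ℝ) := by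
  refine ⟨(waveMatrix n d 0).transpose * waveMatrix n d d, ?_,
    waveMatrix_transpose_mul_apply hd1⟩
  refine (gamma2_transpose_mul_le _ _).trans_eq ?_
  rw [colNorm_waveMatrix, colNorm_waveMatrix, Real.mul_self_sqrt d.cast_nonneg]
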